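/- As z → ∞ in ℂ \ ℝ, the weighted Cauchy transform of the Hermite polynomial satisfies Φ_n(z) = n!/(2√π i z^{n+1}) + O(z^{-n-2}). In particular, z^{n+1} Φ_n(z) → n!/(2√π i). -/

import Mathlib

open Real MeasureTheory Complex Filter

/-- The (physicists') Hermite polynomial, via the Rodrigues formula. -/
noncomputable def hermiteH (n : ℕ) (x : ℝ) : ℝ :=
  (-1 : ℝ) ^ n * Real.exp (x ^ 2) * iteratedDeriv n (fun t : ℝ => Real.exp (-t ^ 2)) x

/-- The weighted Cauchy transform of the Hermite polynomial `H_n`. -/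
noncomputable def Phi (n : ℕ) (z : ℂ) : ℂ :=
  (1 / (2 * Real.pi * Complex.I)) *
    ∫ x : ℝ, ((Real.exp (-x ^ 2) * hermiteH n x : ℝ) : ℂ) / (z - (x : ℂ))

/-- Polynomial times Gaussian. -/
noncomputable def wG (p : Polynomial ℝ) (x : ℝ) : ℝ := p.eval x * Real.exp (-x ^ 2)

/-- Polynomial `q` with `(p G)' = q G`. -/
noncomputable def dG (p : Polynomial ℝ) : Polynomial ℝ :=
  Polynomial.derivative p - 2 * Polynomial.X * p

lemma wG_hasDerivAt (p : Polynomial ℝ) (x : ℝ) : HasDerivAt (wG p) (wG (dG p) x) x := by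
  have h1 := p.hasDerivAt x
  have h2 : HasDerivAt (fun x : ℝ => Real.exp (-x ^ 2)) (Real.exp (-x ^ 2) * (-(2 * x))) x := by
    have := ((hasDerivAt_pow 2 x).neg).exp
    simpa using this
  have h3 := h1.mul h2
  refine h3.congr_deriv ?_
  simp [wG, dG]
  ring

lemma wG_continuous (p : Polynomial ℝ) : Continuous (wG p) := by
  unfold wG
  fun_prop

lemma wG_bdd (p : Polynomial ℝ) : ∃ M : ℝ, 0 ≤ M ∧ ∀ x, |wG p x| ≤ M := by
  induction p using Polynomial.induction_on' with
  | add p q hp hq =>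
    obtain ⟨M, hM, h⟩ := hp
    obtain ⟨N, hN, h'⟩ := hq
    refine ⟨M + N, by positivity, fun x => ?_⟩
    have : wG (p + q) x = wG p x + wG q x := by simp [wG, add_mul]
    rw [this]
    exact (abs_add_le _ _).trans (add_le_add (h x) (h' x))
  | monomial n a =>
    refine ⟨|a| * (n.factorial * Real.exp 1), by positivity, fun x => ?_⟩
    have e : |wG (Polynomial.monomial n a) x| = |a| * (|x| ^ n * Real.exp (-x ^ 2)) := by
      simp [wG, abs_mul, mul_assoc]
    rw [e]
    refine mul_le_mul_of_nonneg_left ?_ (abs_nonneg a)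
    have h1 := Real.pow_div_factorial_le_exp |x| (abs_nonneg x) n
    have h2 : |x| ≤ 1 + x ^ 2 := by
      rw [← sq_abs]; nlinarith [sq_nonneg (|x| - 1), abs_nonneg x]
    rw [div_le_iff₀ (by positivity)] at h1
    calc |x| ^ n * Real.exp (-x ^ 2) ≤ (Real.exp (1 + x ^ 2) * n.factorial) * Real.exp (-x ^ 2) := by
          gcongr
          refine h1.trans ?_
          gcongr
      _ = n.factorial * (Real.exp (1 + x ^ 2) * Real.exp (-x ^ 2)) := by ring
      _ = n.factorial * Real.exp 1 := by rw [← Real.exp_add]; congr 2; ring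

lemma wG_integrable (p : Polynomial ℝ) : Integrable (wG p) := by
  obtain ⟨M, hM, h⟩ := wG_bdd ((1 + Polynomial.X ^ 2) * p)
  refine (integrable_inv_one_add_sq.const_mul M).mono'
    (wG_continuous p).aestronglyMeasurable (ae_of_all _ fun x => ?_)
  have h1 := h x
  have e : wG ((1 + Polynomial.X ^ 2) * p) x = (1 + x ^ 2) * wG p x := by
    simp [wG, mul_assoc]
  have hp : (0 : ℝ) < 1 + x ^ 2 := by positivity
  rw [e, abs_mul, abs_of_pos hp] at h1
  rw [Real.norm_eq_abs, ← div_eq_mul_inv, le_div_iff₀ hp]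
  linarith

lemma wG_lip (p : Polynomial ℝ) : ∃ K : ℝ, 0 ≤ K ∧ ∀ x y, |wG p x - wG p y| ≤ K * |x - y| := by
  obtain ⟨K, hK, h⟩ := wG_bdd (dG p)
  refine ⟨K, hK, fun x y => ?_⟩
  exact Convex.norm_image_sub_le_of_norm_hasDerivWithin_le (s := Set.univ)
    (fun t _ => (wG_hasDerivAt p t).hasDerivWithinAt) (fun t _ => h t) convex_univ
    (Set.mem_univ y) (Set.mem_univ x)

lemma z_sub_ne {z : ℂ} (hz : z.im ≠ 0) (x : ℝ) : z - (x : ℂ) ≠ 0 := by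
  intro h
  apply hz
  have := congrArg Complex.im h
  simpa using this

lemma kernel_integral {z : ℂ} (hz : z.im ≠ 0) :
    ‖∫ x in (z.re - 1)..(z.re + 1), 1 / (z - (x : ℂ))‖ ≤ 2 * π := by
  have hd : ∀ x : ℝ, HasDerivAt (fun x : ℝ => -Complex.log (z - (x : ℂ))) (1 / (z - (x : ℂ))) x := by
    intro x
    have h1 : HasDerivAt (fun x : ℝ => z - (x : ℂ)) (-1) x := by
      simpa using (Complex.ofRealCLM.hasDerivAt (x := x)).const_sub z
    have h2 := (h1.clog_real (Or.inr (by simpa using hz))).neg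
    refine h2.congr_deriv ?_
    ring
  have hc : Continuous (fun x : ℝ => 1 / (z - (x : ℂ))) :=
    continuous_const.div (by fun_prop) (z_sub_ne hz)
  rw [intervalIntegral.integral_eq_sub_of_hasDerivAt (fun x _ => hd x) (hc.intervalIntegrable _ _)]
  have e1 : z - ((z.re + 1 : ℝ) : ℂ) = ⟨-1, z.im⟩ := by apply Complex.ext <;> simp
  have e2 : z - ((z.re - 1 : ℝ) : ℂ) = ⟨1, z.im⟩ := by apply Complex.ext <;> simp
  rw [e1, e2]
  have hn : ‖(⟨-1, z.im⟩ : ℂ)‖ = ‖(⟨1, z.im⟩ : ℂ)‖ := by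
    simp [Complex.norm_def, Complex.normSq_apply]
  have : -Complex.log ⟨-1, z.im⟩ - -Complex.log ⟨1, z.im⟩
      = ((Complex.arg ⟨1, z.im⟩ - Complex.arg ⟨-1, z.im⟩ : ℝ) : ℂ) * Complex.I := by
    rw [Complex.log, Complex.log, hn]
    push_cast
    ring
  rw [this, norm_mul, Complex.norm_I, mul_one, Complex.norm_real]
  refine (norm_sub_le _ _).trans ?_
  have h1 := Complex.abs_arg_le_pi ⟨1, z.im⟩
  have h2 := Complex.abs_arg_le_pi ⟨-1, z.im⟩
  rw [Real.norm_eq_abs, Real.norm_eq_abs]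
  linarith

/-- Cauchy transform. -/
noncomputable def JG (p : Polynomial ℝ) (z : ℂ) : ℂ := ∫ x : ℝ, (wG p x : ℂ) / (z - (x : ℂ))

lemma JG_integrable (p : Polynomial ℝ) {z : ℂ} (hz : z.im ≠ 0) :
    Integrable (fun x : ℝ => (wG p x : ℂ) / (z - (x : ℂ))) := by
  have hc : Continuous (fun x : ℝ => (wG p x : ℂ) / (z - (x : ℂ))) :=
    (Complex.continuous_ofReal.comp (wG_continuous p)).div (by fun_prop) (z_sub_ne hz)
  refine ((wG_integrable p).norm.mul_const (|z.im|⁻¹)).mono' hc.aestronglyMeasurable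
    (ae_of_all _ fun x => ?_)
  rw [norm_div, Complex.norm_real, div_eq_mul_inv]
  have h1 : |z.im| ≤ ‖z - (x : ℂ)‖ := by
    have := Complex.abs_im_le_norm (z - (x : ℂ))
    simpa using this
  have h0 : 0 < |z.im| := abs_pos.mpr hz
  gcongr

lemma JG_bdd (p : Polynomial ℝ) : ∃ C : ℝ, ∀ z : ℂ, z.im ≠ 0 → ‖JG p z‖ ≤ C := by
  obtain ⟨M, hM, hMb⟩ := wG_bdd p
  obtain ⟨K, hK, hKb⟩ := wG_lip p
  refine ⟨(K * 2 + M * (2 * π)) + ∫ x, ‖wG p x‖, fun z hz => ?_⟩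
  have hi := JG_integrable p hz
  set s : Set ℝ := Set.Ioc (z.re - 1) (z.re + 1) with hs
  have hre : ∀ x : ℝ, |x - z.re| ≤ ‖z - (x : ℂ)‖ := by
    intro x
    have := Complex.abs_re_le_norm (z - (x : ℂ))
    rw [abs_sub_comm]
    simpa using this
  have hpos : ∀ x : ℝ, 0 < ‖z - (x : ℂ)‖ := fun x => norm_pos_iff.mpr (z_sub_ne hz x)
  have hk : Continuous (fun x : ℝ => 1 / (z - (x : ℂ))) :=
    continuous_const.div (by fun_prop) (z_sub_ne hz)
  unfold JG
  rw [← integral_add_compl (s := s) measurableSet_Ioc hi]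
  refine (norm_add_le _ _).trans (add_le_add ?_ ?_)
  · have hle : z.re - 1 ≤ z.re + 1 := by linarith
    rw [hs, ← intervalIntegral.integral_of_le hle]
    have hsplit : (fun x : ℝ => (wG p x : ℂ) / (z - (x : ℂ))) = fun x : ℝ =>
        ((wG p x - wG p z.re : ℝ) : ℂ) / (z - (x : ℂ)) + (wG p z.re : ℂ) * (1 / (z - (x : ℂ))) := by
      funext x
      push_cast
      ring
    have hc1 : Continuous (fun x : ℝ => ((wG p x - wG p z.re : ℝ) : ℂ) / (z - (x : ℂ))) :=
      (Complex.continuous_ofReal.comp ((wG_continuous p).sub continuous_const)).div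
        (by fun_prop) (z_sub_ne hz)
    rw [hsplit, intervalIntegral.integral_add (hc1.intervalIntegrable _ _)
      ((hk.const_mul _).intervalIntegrable _ _), intervalIntegral.integral_const_mul]
    refine (norm_add_le _ _).trans (add_le_add ?_ ?_)
    · have := intervalIntegral.norm_integral_le_of_norm_le_const (a := z.re - 1) (b := z.re + 1)
        (C := K) (f := fun x : ℝ => ((wG p x - wG p z.re : ℝ) : ℂ) / (z - (x : ℂ))) ?_
      · refine this.trans (le_of_eq ?_)
        have : z.re + 1 - (z.re - 1) = 2 := by ring
        rw [this]; norm_num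
      · intro x _
        rw [norm_div, Complex.norm_real, div_le_iff₀ (hpos x)]
        exact (hKb x z.re).trans (mul_le_mul_of_nonneg_left (hre x) hK)
    · rw [norm_mul, Complex.norm_real]
      exact mul_le_mul (hMb _) (kernel_integral hz) (norm_nonneg _) hM
  · refine (norm_integral_le_integral_norm _).trans ?_
    refine le_trans ?_ (setIntegral_le_integral (s := sᶜ) (wG_integrable p).norm
      (ae_of_all _ fun x => norm_nonneg _))
    refine setIntegral_mono_on hi.norm.integrableOn (wG_integrable p).norm.integrableOn
      measurableSet_Ioc.compl fun x hx => ?_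
    rw [norm_div, Complex.norm_real]
    refine div_le_self (norm_nonneg _) (le_trans ?_ (hre x))
    by_contra hcon
    push Not at hcon
    rw [abs_lt] at hcon
    exact hx ⟨by linarith [hcon.1], by linarith [hcon.2]⟩

lemma JG_step (p : Polynomial ℝ) {z : ℂ} (hz : z.im ≠ 0) :
    z * JG p z = ((∫ x, wG p x : ℝ) : ℂ) + JG (Polynomial.X * p) z := by
  have hw : Integrable (fun x : ℝ => (wG p x : ℂ)) := (wG_integrable p).ofReal
  unfold JG
  rw [← integral_const_mul, show ((∫ x, wG p x : ℝ) : ℂ) = ∫ x, (wG p x : ℂ) from integral_ofReal.symm,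
    ← integral_add hw (JG_integrable _ hz)]
  congr 1
  funext x
  have := z_sub_ne hz x
  have e : wG (Polynomial.X * p) x = x * wG p x := by simp [wG, mul_assoc]
  rw [e]
  push_cast
  field_simp
  ring

/-- The polynomial factor of the n-th derivative of the Gaussian. -/
noncomputable def pG (n : ℕ) : Polynomial ℝ := dG^[n] 1

lemma iter_eq (n : ℕ) : iteratedDeriv n (fun t : ℝ => Real.exp (-t ^ 2)) = wG (pG n) := by
  induction n with
  | zero => funext x; simp [pG, wG]
  | succ n ih =>
    rw [iteratedDeriv_succ, ih]
    funext x
    rw [(wG_hasDerivAt _ x).deriv, pG, pG, Function.iterate_succ_apply']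

lemma parts (p q : Polynomial ℝ) :
    ∫ x, wG (p * dG q) x = - ∫ x, wG (Polynomial.derivative p * q) x := by
  have h := integral_mul_deriv_eq_deriv_mul_of_integrable (u := fun x => p.eval x) (v := wG q)
    (u' := fun x => (Polynomial.derivative p).eval x) (v' := wG (dG q))
    (fun x _ => p.hasDerivAt x) (fun x _ => wG_hasDerivAt q x) ?_ ?_ ?_
  · simpa [wG, mul_assoc] using h
  · refine (wG_integrable (p * dG q)).congr (ae_of_all _ fun x => ?_)
    simp [wG, mul_assoc]
  · refine (wG_integrable (Polynomial.derivative p * q)).congr (ae_of_all _ fun x => ?_)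
    simp [wG, mul_assoc]
  · refine (wG_integrable (p * q)).congr (ae_of_all _ fun x => ?_)
    simp [wG, mul_assoc]

lemma parts_iter (n : ℕ) (p : Polynomial ℝ) :
    ∫ x, wG (p * pG n) x = (-1) ^ n * ∫ x, wG (Polynomial.derivative^[n] p) x := by
  induction n generalizing p with
  | zero => simp [pG]
  | succ n ih =>
    have : pG (n + 1) = dG (pG n) := by rw [pG, pG, Function.iterate_succ_apply']
    rw [this, parts, ih, Function.iterate_succ_apply]
    ring

lemma moment_lt {n k : ℕ} (h : k < n) : ∫ x, wG (Polynomial.X ^ k * pG n) x = 0 := by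
  rw [parts_iter, Polynomial.iterate_derivative_eq_zero (by simpa using h)]
  simp [wG]

lemma moment_eq (n : ℕ) :
    ∫ x, wG (Polynomial.X ^ n * pG n) x = (-1) ^ n * (n.factorial * √π) := by
  rw [parts_iter, Polynomial.iterate_derivative_X_pow_eq_natCast_mul]
  have := integral_gaussian 1
  simp only [neg_mul, one_mul, div_one] at this
  simp [wG, Nat.descFactorial_self, integral_const_mul, this]

lemma JG_pow {n m : ℕ} (h : m ≤ n) {z : ℂ} (hz : z.im ≠ 0) :
    z ^ m * JG (pG n) z = JG (Polynomial.X ^ m * pG n) z := by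
  induction m with
  | zero => simp
  | succ m ih =>
    rw [pow_succ', mul_assoc, ih (by omega), JG_step _ hz, moment_lt (by omega), pow_succ',
      mul_assoc]
    simp

lemma Phi_eq (n : ℕ) (z : ℂ) :
    Phi n z = (1 / (2 * π * Complex.I)) * ((-1) ^ n * JG (pG n) z) := by
  unfold Phi JG
  rw [← integral_const_mul ((-1 : ℂ) ^ n)]
  congr 2
  funext x
  have : Real.exp (-x ^ 2) * hermiteH n x = (-1) ^ n * wG (pG n) x := by
    rw [hermiteH, iter_eq]
    have : Real.exp (-x ^ 2) * Real.exp (x ^ 2) = 1 := by rw [← Real.exp_add]; simp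
    linear_combination ((-1) ^ n * wG (pG n) x) * this
  rw [this]
  push_cast
  ring

lemma key (n : ℕ) : ∃ C : ℝ, ∀ z : ℂ, z.im ≠ 0 →
    ‖z * (z ^ (n + 1) * Phi n z - (n.factorial : ℂ) / (2 * Real.sqrt Real.pi * Complex.I))‖ ≤ C := by
  obtain ⟨C, hC⟩ := JG_bdd (Polynomial.X * (Polynomial.X * (Polynomial.X ^ n * pG n)))
  refine ⟨‖(1 / (2 * π * Complex.I) : ℂ)‖ *
    (‖((∫ x, wG (Polynomial.X * (Polynomial.X ^ n * pG n)) x : ℝ) : ℂ)‖ + C), fun z hz => ?_⟩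
  have h0 := JG_pow (le_refl n) hz
  have h1 := JG_step (Polynomial.X ^ n * pG n) hz
  have h2 := JG_step (Polynomial.X * (Polynomial.X ^ n * pG n)) hz
  rw [moment_eq] at h1
  push_cast at h1
  have hs : ((-1 : ℂ) ^ n) * (-1) ^ n = 1 := by rw [← mul_pow]; simp
  have hpi : ((√π : ℝ) : ℂ) * (√π : ℝ) = π := by
    rw [← Complex.ofReal_mul, Real.mul_self_sqrt Real.pi_pos.le]
  have hne : ((√π : ℝ) : ℂ) ≠ 0 := by
    rw [Complex.ofReal_ne_zero]; exact (Real.sqrt_pos.mpr Real.pi_pos).ne'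
  have hf : (n.factorial : ℂ) / (2 * Real.sqrt Real.pi * Complex.I)
      = (1 / (2 * π * Complex.I)) * (n.factorial * √π) := by
    rw [← hpi]
    field_simp
  have e : z * (z ^ (n + 1) * Phi n z - (n.factorial : ℂ) / (2 * Real.sqrt Real.pi * Complex.I))
      = (1 / (2 * π * Complex.I)) * ((-1) ^ n *
        (((∫ x, wG (Polynomial.X * (Polynomial.X ^ n * pG n)) x : ℝ) : ℂ) +
          JG (Polynomial.X * (Polynomial.X * (Polynomial.X ^ n * pG n))) z)) := by
    rw [hf, Phi_eq, ← h2]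
    generalize (1 / (2 * π * Complex.I) : ℂ) = c
    have h3 : z ^ (n + 1) * JG (pG n) z = (-1) ^ n * (n.factorial * √π) +
        JG (Polynomial.X * (Polynomial.X ^ n * pG n)) z := by
      rw [← h1, ← h0]; ring
    linear_combination z * c * (-1) ^ n * h3 + z * c * n.factorial * √π * hs
  rw [e, norm_mul]
  gcongr
  rw [norm_mul, norm_pow, norm_neg, norm_one, one_pow, one_mul]
  exact (norm_add_le _ _).trans (by gcongr; exact hC z hz)

theorem Phi_asymptotics_at_infinity (n : ℕ) :
    (fun z : ℂ => Phi n z - (n.factorial : ℂ) / (2 * Real.sqrt Real.pi * Complex.I * z ^ (n + 1)))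
      =O[Bornology.cobounded ℂ ⊓ Filter.principal {z : ℂ | z.im ≠ 0}]
      (fun z : ℂ => ‖z‖⁻¹ ^ (n + 2)) ∧
    Tendsto (fun z : ℂ => z ^ (n + 1) * Phi n z)
      (Bornology.cobounded ℂ ⊓ Filter.principal {z : ℂ | z.im ≠ 0})
      (nhds ((n.factorial : ℂ) / (2 * Real.sqrt Real.pi * Complex.I))) := by
  obtain ⟨C, hC⟩ := key n
  have hmem : ∀ᶠ z : ℂ in Bornology.cobounded ℂ ⊓ Filter.principal {z : ℂ | z.im ≠ 0}, z.im ≠ 0 :=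
    mem_inf_of_right (mem_principal_self _)
  constructor
  · refine Asymptotics.IsBigO.of_bound C ?_
    filter_upwards [hmem] with z hz
    have hz0 : z ≠ 0 := by rintro rfl; simp at hz
    have h := hC z hz
    set A : ℂ := 2 * Real.sqrt Real.pi * Complex.I
    have e : Phi n z - (n.factorial : ℂ) / (A * z ^ (n + 1)) =
        (z * (z ^ (n + 1) * Phi n z - (n.factorial : ℂ) / A)) * z⁻¹ ^ (n + 2) := by
      rw [div_mul_eq_div_div]
      generalize (n.factorial : ℂ) / A = B
      rw [inv_pow]
      field_simp
      ring
    rw [e, norm_mul]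
    simp only [norm_pow, norm_inv, norm_norm]
    gcongr
  · rw [tendsto_iff_norm_sub_tendsto_zero]
    have hlim : Tendsto (fun z : ℂ => C * ‖z‖⁻¹)
        (Bornology.cobounded ℂ ⊓ Filter.principal {z : ℂ | z.im ≠ 0}) (nhds 0) := by
      have := (tendsto_norm_cobounded_atTop (E := ℂ)).inv_tendsto_atTop.const_mul C
      rw [mul_zero] at this
      exact this.mono_left inf_le_left
    refine squeeze_zero' (Eventually.of_forall fun z => norm_nonneg _) ?_ hlim
    filter_upwards [hmem] with z hz
    have hz0 : z ≠ 0 := by rintro rfl; simp at hz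
    have h := hC z hz
    rw [norm_mul] at h
    rw [← div_eq_mul_inv, le_div_iff₀ (norm_pos_iff.mpr hz0)]
    linarith
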